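/- Let P = ⟨H,M,T⟩ be an abduction problem whose theory T is a set of clauses over a set V of n propositional variables, let Πₙ denote the set of all clauses over V, and let C = { c_γ : γ ∈ Πₙ } be a set of fresh propositional variables in one-to-one correspondence with Πₙ. For H₁ ⊆ H define H₂ = H₁ ∪ { c_γ : γ ∈ T }, and define P' = ⟨H',M',T'⟩ by H' = H ∪ C, M' = M, and T' = { c_γ → γ : γ ∈ Πₙ }. Then H₁ ∪ T is satisfiable if and only if H₂ ∪ T' is satisfiable. -/

import Mathlib

/-- Propositional formulas over a set `V` of variables. -/
inductive PropForm (V : Type) : Type where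
  | fls  : PropForm V
  | var  : V → PropForm V
  | neg  : PropForm V → PropForm V
  | conj : PropForm V → PropForm V → PropForm V
  | disj : PropForm V → PropForm V → PropForm V
  | imp  : PropForm V → PropForm V → PropForm V
  deriving DecidableEq

namespace PropForm

/-- Truth of a formula under a valuation. -/
def eval {V : Type} (v : V → Prop) : PropForm V → Prop
  | fls => False
  | var x => v x
  | neg φ => ¬ eval v φ
  | conj φ ψ => eval v φ ∧ eval v ψ
  | disj φ ψ => eval v φ ∨ eval v ψ
  | imp φ ψ => eval v φ → eval v ψ

/-- The set of variables occurring in a formula. -/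
def vars {V : Type} : PropForm V → Set V
  | fls => ∅
  | var x => {x}
  | neg φ => vars φ
  | conj φ ψ => vars φ ∪ vars ψ
  | disj φ ψ => vars φ ∪ vars ψ
  | imp φ ψ => vars φ ∪ vars ψ

end PropForm

/-- An abduction problem `⟨H, M, T⟩`: hypotheses, manifestations, theory. -/
structure AbdProblem (V : Type) [DecidableEq V] : Type where
  H : Finset V
  M : Finset V
  T : Finset (PropForm V)

variable {V : Type} [DecidableEq V]

/-- `v` is a model of the hypotheses `A` together with the theory `T`. -/
def models (v : V → Prop) (A : Finset V) (T : Finset (PropForm V)) : Prop :=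
  (∀ x ∈ A, v x) ∧ (∀ φ ∈ T, φ.eval v)

/-- `A` is a solution of `P`: `A ⊆ H`, `A ∪ T` is satisfiable, `A ∪ T ⊨ m` for `m ∈ M`. -/
def isSol (P : AbdProblem V) (A : Finset V) : Prop :=
  A ⊆ P.H ∧ (∃ v, models v A P.T) ∧ ∀ v, models v A P.T → ∀ m ∈ P.M, v m

/-- The set of solutions of `P`. -/
def SOL (P : AbdProblem V) : Set (Finset V) := {A | isSol P A}

/-- The solutions of `P` minimal under set inclusion. -/
def SOLsub (P : AbdProblem V) : Set (Finset V) :=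
  {A | A ∈ SOL P ∧ ∀ B ∈ SOL P, B ⊆ A → B = A}

/-- The solutions of `P` of minimum cardinality. -/
def SOLcard (P : AbdProblem V) : Set (Finset V) :=
  {A | A ∈ SOL P ∧ ∀ B ∈ SOL P, A.card ≤ B.card}

/-- `x` is fresh for `P`: it occurs neither in `H`, nor in `M`, nor in any formula of `T`. -/
def freshFor (P : AbdProblem V) (x : V) : Prop :=
  x ∉ P.H ∧ x ∉ P.M ∧ ∀ φ ∈ P.T, x ∉ φ.vars

/-- A clause, given as a pair (positive variables, negated variables),
    rendered as a disjunction of literals. -/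
noncomputable def clauseForm (γ : Finset V × Finset V) : PropForm V :=
  (γ.1.toList.map PropForm.var
    ++ γ.2.toList.map (fun x => PropForm.neg (PropForm.var x))).foldr
    PropForm.disj PropForm.fls

/-- `Πₙ`: the set of all clauses over the variable set `W`. -/
def allClauses (W : Finset V) : Finset (Finset V × Finset V) :=
  W.powerset ×ˢ W.powerset

/-- The truth value of a formula depends only on the variables occurring in it. -/
theorem PropForm.eval_congr {U : Type} {v w : U → Prop} (φ : PropForm U)
    (h : ∀ x ∈ φ.vars, v x ↔ w x) : φ.eval v ↔ φ.eval w := by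
  induction φ with
  | fls => exact Iff.rfl
  | var x => exact h x rfl
  | neg φ ih => exact not_congr (ih h)
  | conj φ ψ ihφ ihψ =>
    exact and_congr (ihφ fun x hx => h x (Or.inl hx)) (ihψ fun x hx => h x (Or.inr hx))
  | disj φ ψ ihφ ihψ =>
    exact or_congr (ihφ fun x hx => h x (Or.inl hx)) (ihψ fun x hx => h x (Or.inr hx))
  | imp φ ψ ihφ ihψ =>
    exact imp_congr (ihφ fun x hx => h x (Or.inl hx)) (ihψ fun x hx => h x (Or.inr hx))

theorem compile_preserves_satisfiability (H M W : Finset V) (n : ℕ) (hW : W.card = n)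
    (Tc : Finset (Finset V × Finset V)) (hTc : Tc ⊆ allClauses W)
    (c : Finset V × Finset V → V)
    (hcinj : Set.InjOn c ↑(allClauses W))
    (hcfresh : ∀ γ ∈ allClauses W, freshFor ⟨H, M, Tc.image clauseForm⟩ (c γ))
    (H₁ : Finset V) (hH₁ : H₁ ⊆ H) :
    (∃ v, models v H₁ (Tc.image clauseForm)) ↔
    (∃ v, models v (H₁ ∪ Tc.image c)
      ((allClauses W).image (fun γ => PropForm.imp (PropForm.var (c γ)) (clauseForm γ)))) := by
  constructor
  · rintro ⟨v, hvH, hvT⟩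
    refine ⟨fun x => x ∈ Tc.image c ∨ (x ∉ (allClauses W).image c ∧ v x), ?_, ?_⟩
    · intro x hx
      rcases Finset.mem_union.1 hx with hx | hx
      · refine Or.inr ⟨fun hxc => ?_, hvH x hx⟩
        obtain ⟨γ, hγ, rfl⟩ := Finset.mem_image.1 hxc
        exact (hcfresh γ hγ).1 (hH₁ hx)
      · exact Or.inl hx
    · intro φ hφ
      obtain ⟨γ, hγ, rfl⟩ := Finset.mem_image.1 hφ
      intro hc
      have hγT : γ ∈ Tc := by
        rcases hc with hc | ⟨hc, -⟩
        · obtain ⟨δ, hδ, hδγ⟩ := Finset.mem_image.1 hc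
          exact hcinj (hTc hδ) hγ hδγ ▸ hδ
        · exact absurd (Finset.mem_image_of_mem c hγ) hc
      have hmem : clauseForm γ ∈ Tc.image clauseForm := Finset.mem_image_of_mem _ hγT
      refine (PropForm.eval_congr _ fun x hx => ?_).1 (hvT _ hmem)
      have hxc : x ∉ (allClauses W).image c := by
        intro hxc
        obtain ⟨δ, hδ, rfl⟩ := Finset.mem_image.1 hxc
        exact (hcfresh δ hδ).2.2 _ hmem hx
      have hxT : x ∉ Tc.image c := fun hxT => hxc (Finset.image_subset_image hTc hxT)
      simp only [hxc, hxT, not_false_eq_true, true_and, false_or]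
  · rintro ⟨v, hvH, hvT⟩
    refine ⟨v, fun x hx => hvH x (Finset.mem_union_left _ hx), fun φ hφ => ?_⟩
    obtain ⟨γ, hγ, rfl⟩ := Finset.mem_image.1 hφ
    exact hvT _ (Finset.mem_image_of_mem _ (hTc hγ))
      (hvH _ (Finset.mem_union_right _ (Finset.mem_image_of_mem c hγ)))
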